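/- Let n ≥ 1, K ≥ 1, t ≤ n, τ ≥ 0, let J = (C_1, …, C_m) be a (t,τ)-pseudo-random K-formula over n variables, let ψ ∈ {±1}^n, and let d be an integer with 1 ≤ d ≤ t, d ≤ K, and K·2^d·n^d·τ/d < d. Then there exists a real polynomial p : ℝ^{nK} → ℝ of total degree at most d such that the fraction of indices j ∈ [m] with p(π(C_j)) ≠ XOR_K(C_j(ψ)) is at most 2·exp(−D(1/2 + d/(2K), 1/2 + 2^{d−1}·n^d·τ/d)·K). -/

import Mathlib

/-- A `K`-tuple over `n` Boolean variables: `K` literals on `K` distinct variables. -/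
def KTuple (n K : ℕ) : Type :=
  { p : (Fin K → Fin n) × (Fin K → ℤˣ) // Function.Injective p.1 }

/-- A partial `K`-tuple supported in `A ⊆ [K]`. -/
def PartialTuple (n K : ℕ) (A : Finset (Fin K)) : Type :=
  { p : (↥A → Fin n) × (↥A → ℤˣ) // Function.Injective p.1 }

/-- Restriction of a `K`-tuple to the coordinates in `A`. -/
def KTuple.restrict {n K : ℕ} (C : KTuple n K) (A : Finset (Fin K)) :
    PartialTuple n K A :=
  ⟨(fun a => C.1.1 a.1, fun a => C.1.2 a.1), fun _ _ h => Subtype.ext (C.2 h)⟩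

/-- Evaluation `C(ψ)_i = s_i · ψ_{v(i)}` of a `K`-tuple at an assignment `ψ ∈ {±1}^n`. -/
def KTuple.evalAt {n K : ℕ} (C : KTuple n K) (ψ : Fin n → ℤˣ) : Fin K → ℤˣ :=
  fun i => C.1.2 i * ψ (C.1.1 i)

/-- The frequency `Fr_J(C)` of a partial `K`-tuple `C` in the formula `J`. -/
noncomputable def freq {n K : ℕ} {ι : Type} [Fintype ι] (J : ι → KTuple n K)
    {A : Finset (Fin K)} (C : PartialTuple n K A) : ℝ :=
  (Nat.card {j : ι // KTuple.restrict (J j) A = C} : ℝ) / (Fintype.card ι : ℝ)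

/-- `p_{n,t} = 1/((2n)(2n−2)⋯(2n−2t+2))`. -/
noncomputable def pFreq (n t : ℕ) : ℝ :=
  1 / ∏ i ∈ Finset.range t, ((2 * n : ℝ) - 2 * i)

/-- `J` is `(t,τ)`-pseudo-random. -/
def PseudoRandom {n K : ℕ} {ι : Type} [Fintype ι] (J : ι → KTuple n K)
    (t : ℕ) (τ : ℝ) : Prop :=
  ∀ A : Finset (Fin K), A.card ≤ t →
    ∀ C : PartialTuple n K A, |freq J C - pFreq n A.card| < τ

/-- Kullback–Leibler divergence between `Bernoulli p` and `Bernoulli q`. -/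
noncomputable def klBer (p q : ℝ) : ℝ :=
  p * Real.log (p / q) + (1 - p) * Real.log ((1 - p) / (1 - q))

/-- `π : X_{n,K} → {−1,0,1}^{nK}`: concatenation of signed indicator vectors of the literals. -/
noncomputable def piMap {n K : ℕ} (C : KTuple n K) : Fin K × Fin n → ℝ :=
  fun p => if C.1.1 p.1 = p.2 then ((C.1.2 p.1 : ℤ) : ℝ) else 0

/-- `XOR_K(C(ψ)) = ∏_i C(ψ)_i`, as a real number. -/
noncomputable def xorVal {n K : ℕ} (C : KTuple n K) (ψ : Fin n → ℤˣ) : ℝ :=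
  ∏ i, ((KTuple.evalAt C ψ i : ℤ) : ℝ)

section

open Finset

/-- The convex potential whose increments dominate `log (q * (a - i) / (b - i))`. -/
noncomputable def ratioPotential (q a b x : ℝ) : ℝ :=
  x * Real.log q - (a - x) * Real.log (a - x) + (b - x) * Real.log (b - x)

lemma mul_log_ratio_le_ratioPotential_sub {q a b x h : ℝ} (hq : 0 < q) (hab : b ≤ a)
    (hx : x < b) (hxh : x + h < b) :
    h * Real.log (q * (a - x) / (b - x)) ≤
      ratioPotential q a b (x + h) - ratioPotential q a b x := by
  have hA : 0 < a - x := by linarith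
  have hB : 0 < b - x := by linarith
  have hA' : 0 < a - x - h := by linarith
  have hB' : 0 < b - x - h := by linarith
  have h1 : Real.log ((a - x - h) / (a - x) * ((b - x) / (b - x - h))) ≤
      (a - x - h) / (a - x) * ((b - x) / (b - x - h)) - 1 :=
    Real.log_le_sub_one_of_pos (by positivity)
  have h2 : Real.log ((a - x - h) / (a - x)) ≤ (a - x - h) / (a - x) - 1 :=
    Real.log_le_sub_one_of_pos (by positivity)
  have h1' := mul_le_mul_of_nonneg_left h1 hB'.le
  have h2' := mul_le_mul_of_nonneg_left h2 (sub_nonneg.2 hab)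
  have e : (b - x - h) * ((a - x - h) / (a - x) * ((b - x) / (b - x - h)) - 1) +
      (a - b) * ((a - x - h) / (a - x) - 1) = 0 := by
    field_simp
    ring
  rw [Real.log_mul (by positivity) (by positivity), Real.log_div hA'.ne' hA.ne',
    Real.log_div hB.ne' hB'.ne'] at h1'
  rw [Real.log_div hA'.ne' hA.ne'] at h2'
  rw [Real.log_div (by positivity) hB.ne', Real.log_mul hq.ne' hA.ne']
  unfold ratioPotential
  rw [← sub_sub a x h, ← sub_sub b x h]
  nlinarith

lemma prod_ratio_le_exp_ratioPotential {q a b : ℝ} (hq : 0 < q) (hab : b ≤ a) (k : ℕ)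
    (hk : (k : ℝ) < b) :
    ∏ i ∈ range k, (q * (a - i) / (b - i)) ≤
      Real.exp (ratioPotential q a b k - ratioPotential q a b 0) := by
  induction k with
  | zero => simp
  | succ k ih =>
    push_cast at hk
    have hk' : (k : ℝ) < b := by linarith
    have hpos : 0 < q * (a - k) / (b - k) :=
      div_pos (mul_pos hq (by linarith)) (by linarith)
    have hstep := mul_log_ratio_le_ratioPotential_sub hq hab hk' hk
    rw [one_mul, Real.log_le_iff_le_exp hpos] at hstep
    rw [prod_range_succ]
    calc _ ≤ Real.exp (ratioPotential q a b k - ratioPotential q a b 0) *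
          Real.exp (ratioPotential q a b (k + 1) - ratioPotential q a b k) :=
          mul_le_mul (ih hk') hstep hpos.le (Real.exp_pos _).le
      _ = _ := by
        rw [← Real.exp_add]
        push_cast
        ring_nf

lemma ratioPotential_sub_eq_neg_klBer {q a b : ℝ} (hq : 0 < q) (hq1 : q < 1) (hb : 0 < b)
    (hab : b < a) :
    ratioPotential q a b ((b - q * a) / (1 - q)) - ratioPotential q a b 0 =
      -(klBer (b / a) q) * a := by
  have ha : 0 < a := hb.trans hab
  have hq' : 0 < 1 - q := by linarith
  have hL : 0 < a - b := by linarith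
  have e1 : a - (b - q * a) / (1 - q) = (a - b) / (1 - q) := by
    field_simp
    ring
  have e2 : b - (b - q * a) / (1 - q) = q * ((a - b) / (1 - q)) := by
    field_simp
    ring
  have e3 : 1 - b / a = (a - b) / a := by
    field_simp
  unfold ratioPotential klBer
  rw [e1, e2, e3, Real.log_mul hq.ne' (by positivity), Real.log_div hL.ne' hq'.ne',
    Real.log_div (by positivity) hq.ne', Real.log_div hb.ne' ha.ne',
    Real.log_div (by positivity) hq'.ne', Real.log_div hL.ne' ha.ne']
  simp only [sub_zero, zero_mul]
  field_simp
  ring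

/-- Some initial product of the ratios is at most the Chernoff bound `exp (-D(b/a, q) a)`. -/
lemma exists_prod_ratio_le_exp_neg_klBer {q a b : ℝ} (hq : 0 < q) (hq1 : q < 1)
    (hqb : q * a < b) (hab : b < a) :
    ∃ k : ℕ, (k : ℝ) < (b - q * a) / (1 - q) ∧ (k : ℝ) < b ∧
      ∏ i ∈ range (k + 1), (q * (a - i) / (b - i)) ≤ Real.exp (-(klBer (b / a) q) * a) := by
  have hq' : 0 < 1 - q := by linarith
  have ha : 0 < a := by nlinarith
  have hb : 0 < b := by nlinarith
  set x := (b - q * a) / (1 - q) with hx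
  have hx0 : 0 < x := div_pos (by linarith) hq'
  have hxb : x < b := by
    rw [hx, div_lt_iff₀ hq']
    nlinarith
  obtain ⟨k, hk⟩ := Nat.exists_eq_add_one.2 (Nat.ceil_pos.2 hx0)
  have hkx : (k : ℝ) < x := Nat.lt_ceil.1 (by omega)
  have hxk : x ≤ k + 1 := by
    have := Nat.le_ceil x
    rw [hk] at this
    exact_mod_cast this
  have hkb : (k : ℝ) < b := hkx.trans hxb
  refine ⟨k, hkx, hkb, ?_⟩
  have hbk : 0 < b - k := by linarith
  have hpos : 0 < q * (a - k) / (b - k) := div_pos (mul_pos hq (by linarith)) hbk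
  have hle1 : q * (a - k) / (b - k) ≤ 1 := by
    rw [div_le_one hbk]
    have := (lt_div_iff₀ hq').1 hkx
    nlinarith
  have hlog : Real.log (q * (a - k) / (b - k)) ≤ 0 := Real.log_nonpos hpos.le hle1
  have hstep := mul_log_ratio_le_ratioPotential_sub (h := x - k) hq hab.le hkb (by linarith)
  have hlast : q * (a - k) / (b - k) ≤
      Real.exp (ratioPotential q a b x - ratioPotential q a b k) := by
    rw [← Real.log_le_iff_le_exp hpos]
    rw [add_sub_cancel] at hstep
    nlinarith
  rw [← ratioPotential_sub_eq_neg_klBer hq hq1 hb hab, prod_range_succ]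
  calc _ ≤ Real.exp (ratioPotential q a b k - ratioPotential q a b 0) *
        Real.exp (ratioPotential q a b x - ratioPotential q a b k) :=
        mul_le_mul (prod_ratio_le_exp_ratioPotential hq hab.le k hkb) hlast hpos.le
          (Real.exp_pos _).le
    _ = _ := by
      rw [← Real.exp_add]
      congr 1
      ring

lemma cast_descFactorial_eq_prod {N k : ℕ} (h : k ≤ N) :
    (N.descFactorial k : ℝ) = ∏ i ∈ range k, ((N : ℝ) - i) := by
  rw [Nat.descFactorial_eq_prod_range, Nat.cast_prod]
  refine prod_congr rfl fun i hi => ?_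
  rw [Nat.cast_sub ((mem_range.1 hi).le.trans h)]

section Tail

open Classical

/-- Markov's inequality for binomial moments. -/
lemma card_le_card_filter_mul_prod_le {ι κ : Type*} [Fintype ι] [Fintype κ] (P : ι → κ → Prop)
    {k : ℕ} {b B : ℝ} (hkb : (k : ℝ) < b + 1) (hk : k ≤ Fintype.card κ)
    (hB : ∀ A : Finset κ, #A = k → (#{j | ∀ i ∈ A, P j i} : ℝ) ≤ B) :
    (#{j | b ≤ (#{i | P j i} : ℝ)} : ℝ) * ∏ i ∈ range k, (b - i) ≤
      (∏ i ∈ range k, ((Fintype.card κ : ℝ) - i)) * B := by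
  have hdc : ∑ j, (#{i | P j i}).choose k =
      ∑ A ∈ powersetCard k (univ : Finset κ), #{j | ∀ i ∈ A, P j i} := by
    have := sum_card_bipartiteAbove_eq_sum_card_bipartiteBelow
      (s := (univ : Finset ι)) (t := powersetCard k (univ : Finset κ))
      fun j A => ∀ i ∈ A, P j i
    refine Eq.trans ?_ this
    refine sum_congr rfl fun j _ => ?_
    rw [← card_powersetCard]
    congr 1
    ext A
    simp [bipartiteAbove, mem_powersetCard, subset_iff, and_comm]
  have hsum : (∑ j, ((#{i | P j i}).choose k : ℝ)) ≤ (Fintype.card κ).choose k * B := by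
    have : (∑ j, ((#{i | P j i}).choose k : ℝ)) =
        ∑ A ∈ powersetCard k (univ : Finset κ), (#{j | ∀ i ∈ A, P j i} : ℝ) := by
      exact_mod_cast hdc
    rw [this]
    refine (sum_le_card_nsmul _ _ B fun A hA => hB A (mem_powersetCard.1 hA).2).trans ?_
    rw [card_powersetCard, nsmul_eq_mul, card_univ]
  have hlow : (#{j | b ≤ (#{i | P j i} : ℝ)} : ℝ) * ∏ i ∈ range k, (b - i) ≤
      ∑ j, ((#{i | P j i}).descFactorial k : ℝ) := by
    rw [← nsmul_eq_mul]
    refine (card_nsmul_le_sum _ _ _ fun j hj => ?_).trans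
      (sum_le_sum_of_subset_of_nonneg (filter_subset _ _) fun _ _ _ => Nat.cast_nonneg _)
    have hj' := (mem_filter.1 hj).2
    have hkN : k ≤ #{i | P j i} := by
      have : (k : ℝ) < #{i | P j i} + 1 := by linarith
      have : k < #{i | P j i} + 1 := by exact_mod_cast this
      omega
    rw [cast_descFactorial_eq_prod hkN]
    refine prod_le_prod (fun i hi => ?_) fun i _ => by linarith
    have : (i : ℝ) + 1 ≤ k := by exact_mod_cast mem_range.1 hi
    linarith
  refine hlow.trans ?_
  simp only [Nat.descFactorial_eq_factorial_mul_choose, Nat.cast_mul]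
  rw [← mul_sum, ← cast_descFactorial_eq_prod hk, Nat.descFactorial_eq_factorial_mul_choose,
    Nat.cast_mul, mul_assoc]
  exact mul_le_mul_of_nonneg_left hsum (Nat.cast_nonneg _)

/-- A Chernoff bound that only uses the joint probabilities of at most `d` events. -/
lemma card_le_card_filter_le_exp_neg_klBer {ι κ : Type*} [Fintype ι] [Fintype κ]
    (P : ι → κ → Prop) {q b : ℝ} {d : ℕ} (hq : 0 < q) (hq1 : q < 1)
    (hqb : q * Fintype.card κ < b) (hb : b < Fintype.card κ)
    (hd : (b - q * Fintype.card κ) / (1 - q) ≤ d)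
    (hP : ∀ A : Finset κ, 1 ≤ #A → #A ≤ d →
      (#{j | ∀ i ∈ A, P j i} : ℝ) ≤ q ^ #A * Fintype.card ι) :
    (#{j | b ≤ (#{i | P j i} : ℝ)} : ℝ) ≤
      Real.exp (-(klBer (b / Fintype.card κ) q) * Fintype.card κ) * Fintype.card ι := by
  obtain ⟨k, hkx, hkb, hk⟩ := exists_prod_ratio_le_exp_neg_klBer hq hq1 hqb hb
  have hkd : k + 1 ≤ d := by
    have : (k : ℝ) < d := hkx.trans_le hd
    exact_mod_cast this
  have hkκ : k + 1 ≤ Fintype.card κ := by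
    have : (k : ℝ) < Fintype.card κ := hkb.trans hb
    exact_mod_cast this
  have hmark := card_le_card_filter_mul_prod_le P (k := k + 1) (b := b)
    (B := q ^ (k + 1) * Fintype.card ι) (by push_cast; linarith) hkκ
    fun A hA => by
      rw [← hA]
      exact hP A (by omega) (by omega)
  have hpos : 0 < ∏ i ∈ range (k + 1), (b - i) := by
    refine prod_pos fun i hi => ?_
    have : (i : ℝ) ≤ k := by exact_mod_cast Nat.lt_succ_iff.1 (mem_range.1 hi)
    linarith
  rw [← le_div_iff₀ hpos] at hmark
  refine hmark.trans (le_trans (le_of_eq ?_) (mul_le_mul_of_nonneg_right hk (Nat.cast_nonneg _)))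
  rw [prod_div_distrib, prod_mul_distrib, prod_const, card_range]
  ring

lemma freq_mul_card {n K : ℕ} {ι : Type} [Fintype ι] (hι : 0 < Fintype.card ι)
    (J : ι → KTuple n K) {A : Finset (Fin K)} (C : PartialTuple n K A) :
    (#{j | KTuple.restrict (J j) A = C} : ℝ) = freq J C * Fintype.card ι := by
  have : (Fintype.card ι : ℝ) ≠ 0 := by positivity
  rw [freq, div_mul_cancel₀ _ this, Nat.card_eq_fintype_card, Fintype.card_subtype]

lemma descFactorial_mul_pFreq {n a : ℕ} (h : a ≤ n) :
    (n.descFactorial a : ℝ) * pFreq n a = (1 / 2) ^ a := by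
  have hpos : ∏ i ∈ range a, ((n : ℝ) - i) ≠ 0 := by
    rw [← cast_descFactorial_eq_prod h, Nat.cast_ne_zero]
    exact (Nat.descFactorial_pos.2 h).ne'
  have : ∏ i ∈ range a, ((2 * n : ℝ) - 2 * i) = 2 ^ a * ∏ i ∈ range a, ((n : ℝ) - i) := by
    simp only [← mul_sub, prod_mul_distrib, prod_const, card_range]
  rw [pFreq, this, cast_descFactorial_eq_prod h, one_div_pow]
  field_simp

/-- In a pseudo-random formula, few tuples have all literals indexed by `A` of value `s`. -/
lemma PseudoRandom.card_forall_evalAt_eq_le {n K t : ℕ} {ι : Type} [Fintype ι] {τ : ℝ}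
    {J : ι → KTuple n K} (hJ : PseudoRandom J t τ) (hι : 0 < Fintype.card ι) (hτ : 0 ≤ τ)
    (ht : t ≤ n) (ψ : Fin n → ℤˣ) (s : ℤˣ) {A : Finset (Fin K)} (hA : #A ≤ t) :
    (#{j | ∀ i ∈ A, KTuple.evalAt (J j) ψ i = s} : ℝ) ≤
      ((1 / 2) ^ #A + (n : ℝ) ^ #A * τ) * Fintype.card ι := by
  let T : (A ↪ Fin n) → PartialTuple n K A := fun f => ⟨(f, fun a => s * ψ (f a)), f.injective⟩
  have hsub : (univ.filter fun j => ∀ i ∈ A, KTuple.evalAt (J j) ψ i = s) ⊆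
      univ.biUnion fun f => univ.filter fun j => KTuple.restrict (J j) A = T f := by
    intro j hj
    have hj' := (mem_filter.1 hj).2
    refine mem_biUnion.2 ⟨⟨_, (KTuple.restrict (J j) A).2⟩, mem_univ _,
      mem_filter.2 ⟨mem_univ _, Subtype.ext (Prod.ext rfl (funext fun a => ?_))⟩⟩
    have := hj' a.1 a.2
    change (J j).1.2 a = s * ψ ((J j).1.1 a)
    rw [← this, KTuple.evalAt, mul_assoc, Int.units_mul_self, mul_one]
  have hcard : (#{j | ∀ i ∈ A, KTuple.evalAt (J j) ψ i = s} : ℝ) ≤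
      ∑ f : A ↪ Fin n, (#{j | KTuple.restrict (J j) A = T f} : ℝ) := by
    exact_mod_cast (card_le_card hsub).trans card_biUnion_le
  refine hcard.trans ((sum_le_card_nsmul _ _ ((pFreq n #A + τ) * Fintype.card ι)
    fun f _ => ?_).trans ?_)
  · rw [freq_mul_card hι]
    refine mul_le_mul_of_nonneg_right ?_ (Nat.cast_nonneg _)
    linarith [(abs_lt.1 (hJ A hA (T f))).2]
  · rw [card_univ, Fintype.card_embedding_eq, nsmul_eq_mul, Fintype.card_fin, Fintype.card_coe,
      ← mul_assoc, mul_add, descFactorial_mul_pFreq (hA.trans ht)]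
    have : (n.descFactorial #A : ℝ) ≤ (n : ℝ) ^ #A := by
      exact_mod_cast Nat.descFactorial_le_pow n _
    gcongr

lemma le_mul_two_pow_sub {a d : ℕ} (ha : 1 ≤ a) (had : a ≤ d) : d ≤ a * 2 ^ (d - a) := by
  obtain ⟨b, rfl⟩ := Nat.exists_eq_add_of_le had
  have : b + 1 ≤ 2 ^ b := Nat.lt_two_pow_self
  rw [Nat.add_sub_cancel_left]
  nlinarith

lemma half_pow_add_le_pow {a d n : ℕ} {τ : ℝ} (hτ : 0 ≤ τ) (ha : 1 ≤ a) (had : a ≤ d)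
    (hn : 1 ≤ n) :
    (1 / 2) ^ a + (n : ℝ) ^ a * τ ≤ (1 / 2 + 2 ^ (d - 1) * (n : ℝ) ^ d * τ / d) ^ a := by
  have hd : (0 : ℝ) < d := by exact_mod_cast ha.trans had
  have hn' : (1 : ℝ) ≤ n := by exact_mod_cast hn
  set ε : ℝ := 2 ^ (d - 1) * (n : ℝ) ^ d * τ / d with hε
  have hε0 : 0 ≤ ε := by positivity
  have hbern := one_add_mul_le_pow (a := 2 * ε) (by linarith) a
  have hsplit : (1 / 2 + ε) ^ a = (1 / 2) ^ a * (1 + 2 * ε) ^ a := by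
    rw [← mul_pow]
    ring
  have hkey : (n : ℝ) ^ a * τ ≤ (1 / 2) ^ a * (a * (2 * ε)) := by
    have h2 : (1 / 2 : ℝ) ^ a * (2 * 2 ^ (d - 1)) = 2 ^ (d - a) := by
      rw [← pow_succ', Nat.sub_add_cancel (ha.trans had), one_div, inv_pow,
        pow_sub₀ _ two_ne_zero had]
      ring
    have e : (1 / 2 : ℝ) ^ a * (a * (2 * ε)) = (a * 2 ^ (d - a) / d) * ((n : ℝ) ^ d * τ) := by
      rw [← h2, hε]
      ring
    have h3 : (1 : ℝ) ≤ a * 2 ^ (d - a) / d := by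
      rw [one_le_div hd]
      exact_mod_cast le_mul_two_pow_sub ha had
    rw [e]
    calc (n : ℝ) ^ a * τ ≤ (n : ℝ) ^ d * τ := by gcongr
      _ ≤ _ := le_mul_of_one_le_left (by positivity) h3
  rw [hsplit]
  have := mul_le_mul_of_nonneg_left hbern (pow_nonneg (by norm_num : (0 : ℝ) ≤ 1 / 2) a)
  linarith

section Signs

variable {κ : Type*} [Fintype κ] (z : κ → ℤˣ)

lemma card_eq_one_add_card_eq_neg_one : #{i | z i = 1} + #{i | z i = -1} = Fintype.card κ := by
  rw [← card_univ, ← card_filter_add_card_filter_not (s := univ) fun i => z i = 1]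
  congr 2
  ext i
  rcases Int.units_eq_one_or (z i) with h | h <;> simp [h]

lemma sum_units_eq_card_sub : ∑ i, ((z i : ℤ) : ℝ) = Fintype.card κ - 2 * #{i | z i = -1} := by
  have h : ∀ i, ((z i : ℤ) : ℝ) = 1 - 2 * if z i = -1 then 1 else 0 := fun i => by
    rcases Int.units_eq_one_or (z i) with h | h <;> norm_num [h]
  simp only [h, sum_sub_distrib, ← mul_sum, sum_boole, sum_const, card_univ, nsmul_eq_mul, mul_one]

lemma prod_units_eq_neg_one_pow : ∏ i, ((z i : ℤ) : ℝ) = (-1) ^ #{i | z i = -1} := by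
  have h : ∀ i, ((z i : ℤ) : ℝ) = if z i = -1 then -1 else 1 := fun i => by
    rcases Int.units_eq_one_or (z i) with h | h <;> norm_num [h]
  simp only [h, prod_ite, prod_const_one, mul_one, prod_const]

end Signs

/-- A polynomial of degree at most `d` recovers the parity of `c` from `K - 2 c` on `d + 1`
central values. -/
lemma exists_polynomial_eval_eq_neg_one_pow (K d : ℕ) :
    ∃ f : Polynomial ℝ, f.natDegree ≤ d ∧ ∀ c : ℕ, K ≤ 2 * c + d → 2 * c ≤ K + d →
      f.eval ((K : ℝ) - 2 * c) = (-1) ^ c := by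
  let v : ℕ → ℝ := fun c => (K : ℝ) - 2 * c
  let S : Finset ℕ := Icc ((K - d + 1) / 2) ((K + d) / 2)
  have hv : Set.InjOn v S := fun x _ y _ hxy => by
    have : (x : ℝ) = y := by simpa [v] using hxy
    exact_mod_cast this
  refine ⟨Lagrange.interpolate S v fun c => (-1) ^ c, ?_, fun c h1 h2 => ?_⟩
  · refine Polynomial.natDegree_le_iff_coeff_eq_zero.2 fun N hN =>
      Polynomial.coeff_eq_zero_of_degree_lt
        ((Lagrange.degree_interpolate_lt _ hv).trans_le ?_)
    have : #S ≤ N := by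
      rw [Nat.card_Icc]
      omega
    exact_mod_cast this
  · exact Lagrange.eval_interpolate_at_node _ hv (mem_Icc.2 ⟨by omega, by omega⟩)

/-- The linear form whose value at `π(C)` is `∑ i, C(ψ)_i`. -/
noncomputable def literalSum {n : ℕ} (K : ℕ) (ψ : Fin n → ℤˣ) :
    MvPolynomial (Fin K × Fin n) ℝ :=
  ∑ p : Fin K × Fin n, MvPolynomial.C ((ψ p.2 : ℤ) : ℝ) * MvPolynomial.X p

lemma totalDegree_literalSum_le {n K : ℕ} (ψ : Fin n → ℤˣ) :
    (literalSum K ψ).totalDegree ≤ 1 := by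
  refine MvPolynomial.totalDegree_finsetSum_le fun p _ => ?_
  refine (MvPolynomial.totalDegree_mul _ _).trans ?_
  rw [MvPolynomial.totalDegree_C, MvPolynomial.totalDegree_X]

lemma eval_piMap_literalSum {n K : ℕ} (C : KTuple n K) (ψ : Fin n → ℤˣ) :
    MvPolynomial.eval (piMap C) (literalSum K ψ) = ∑ i, ((KTuple.evalAt C ψ i : ℤ) : ℝ) := by
  simp [literalSum, piMap, KTuple.evalAt, Fintype.sum_prod_type, mul_comm]

lemma totalDegree_aeval_le {σ : Type*} (f : Polynomial ℝ) (p : MvPolynomial σ ℝ)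
    (hp : p.totalDegree ≤ 1) : (Polynomial.aeval p f).totalDegree ≤ f.natDegree := by
  rw [Polynomial.aeval_eq_sum_range]
  refine MvPolynomial.totalDegree_finsetSum_le fun i hi => ?_
  refine (MvPolynomial.totalDegree_smul_le _ _).trans ((MvPolynomial.totalDegree_pow _ _).trans ?_)
  have := mem_range.1 hi
  nlinarith

/-- Some polynomial of degree at most `d` agrees with `XOR_K(C(ψ))` unless one of the two signs is
taken by more than `(K + d) / 2` of the literals. -/
lemma exists_mvPolynomial_eval_eq_xorVal {n : ℕ} (K d : ℕ) (ψ : Fin n → ℤˣ) :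
    ∃ p : MvPolynomial (Fin K × Fin n) ℝ, p.totalDegree ≤ d ∧ ∀ C : KTuple n K,
      2 * #{i | KTuple.evalAt C ψ i = 1} ≤ K + d → 2 * #{i | KTuple.evalAt C ψ i = -1} ≤ K + d →
        MvPolynomial.eval (piMap C) p = xorVal C ψ := by
  obtain ⟨f, hf, hfe⟩ := exists_polynomial_eval_eq_neg_one_pow K d
  refine ⟨Polynomial.aeval (literalSum K ψ) f,
    (totalDegree_aeval_le f _ (totalDegree_literalSum_le ψ)).trans hf, fun C h1 h2 => ?_⟩
  have hK := card_eq_one_add_card_eq_neg_one (KTuple.evalAt C ψ)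
  rw [Fintype.card_fin] at hK
  rw [Polynomial.aeval_def, Polynomial.hom_eval₂, MvPolynomial.algebraMap_eq,
    show (MvPolynomial.eval (piMap C)).comp MvPolynomial.C = RingHom.id ℝ from
      RingHom.ext fun x => MvPolynomial.eval_C x, eval_piMap_literalSum, xorVal]
  rw [prod_units_eq_neg_one_pow, sum_units_eq_card_sub, Fintype.card_fin]
  exact hfe _ (by omega) h2

lemma PseudoRandom.card_filter_le_exp {n K t d : ℕ} {ι : Type} [Fintype ι] {τ : ℝ}
    {J : ι → KTuple n K} (hJ : PseudoRandom J t τ) (hι : 0 < Fintype.card ι) (hn : 1 ≤ n)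
    (ht : t ≤ n) (hτ : 0 ≤ τ) (hd1 : 1 ≤ d) (hdt : d ≤ t) (hdK : d < K)
    (hcond : (K : ℝ) * 2 ^ d * (n : ℝ) ^ d * τ / d < d) (ψ : Fin n → ℤˣ) (s : ℤˣ) :
    (#{j | ((K : ℝ) + d) / 2 ≤ #{i | KTuple.evalAt (J j) ψ i = s}} : ℝ) ≤
      Real.exp (-(klBer (1 / 2 + d / (2 * K)) (1 / 2 + 2 ^ (d - 1) * (n : ℝ) ^ d * τ / d)) * K) *
        Fintype.card ι := by
  have hd : (0 : ℝ) < d := by exact_mod_cast hd1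
  have hdK' : (d : ℝ) < K := by exact_mod_cast hdK
  have hK : (0 : ℝ) < K := hd.trans hdK'
  have hpow : ∀ A : Finset (Fin K), 1 ≤ #A → #A ≤ d → _ := fun A h1 h2 =>
    (hJ.card_forall_evalAt_eq_le hι hτ ht ψ s (h2.trans hdt)).trans
      (mul_le_mul_of_nonneg_right (half_pow_add_le_pow hτ h1 h2 hn) (Nat.cast_nonneg _))
  have hε0 : 0 ≤ 2 ^ (d - 1) * (n : ℝ) ^ d * τ / d := by positivity
  have hcond' : K * (2 * (2 ^ (d - 1) * (n : ℝ) ^ d * τ / d)) < d := by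
    refine lt_of_eq_of_lt ?_ hcond
    obtain ⟨e, rfl⟩ := Nat.exists_eq_add_of_le' hd1
    rw [Nat.add_sub_cancel, pow_succ]
    ring
  generalize 2 ^ (d - 1) * (n : ℝ) ^ d * τ / d = ε at *
  have hε1 : 2 * ε < 1 := by nlinarith
  have hγ : ((K : ℝ) + d) / 2 / K = 1 / 2 + d / (2 * K) := by
    field_simp
  have := card_le_card_filter_le_exp_neg_klBer
    (fun j i => KTuple.evalAt (J j) ψ i = s) (q := 1 / 2 + ε) (b := ((K : ℝ) + d) / 2) (d := d)
    (by linarith) (by linarith) (by rw [Fintype.card_fin]; linarith)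
    (by rw [Fintype.card_fin]; linarith)
    (by
      rw [Fintype.card_fin, div_le_iff₀ (by linarith)]
      nlinarith)
    (fun A h1 h2 => le_of_eq_of_le (by congr!) (hpow A h1 h2))
  rw [Fintype.card_fin, hγ] at this
  convert this

end Tail

end

/-- if `J = (C_1,…,C_m)` is `(t,τ)`-pseudo-random and `1 ≤ d ≤ min(t,K)` with
`K·2^d·n^d·τ/d < d`, then for every `ψ` there is a polynomial `p` of total degree `≤ d` with
`p(π(C_j)) ≠ XOR_K(C_j(ψ))` on at most a
`2·exp(−D(1/2 + d/(2K), 1/2 + 2^{d−1}n^dτ/d)·K)` fraction of indices. -/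
theorem stmt9 (n K m t d : ℕ) (hn : 1 ≤ n) (hK : 1 ≤ K) (ht : t ≤ n) (hm : 1 ≤ m)
    (τ : ℝ) (hτ : 0 ≤ τ) (J : Fin m → KTuple n K) (hJ : PseudoRandom J t τ)
    (ψ : Fin n → ℤˣ)
    (hd1 : 1 ≤ d) (hdt : d ≤ t) (hdK : d ≤ K)
    (hcond : (K : ℝ) * 2 ^ d * (n : ℝ) ^ d * τ / d < d) :
    ∃ p : MvPolynomial (Fin K × Fin n) ℝ, p.totalDegree ≤ d ∧
      (Nat.card {j : Fin m //
          MvPolynomial.eval (piMap (J j)) p ≠ xorVal (J j) ψ} : ℝ) / m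
        ≤ 2 * Real.exp
            (-(klBer (1 / 2 + d / (2 * K))
                (1 / 2 + 2 ^ (d - 1) * (n : ℝ) ^ d * τ / d)) * K) := by
  obtain ⟨p, hp, hpe⟩ := exists_mvPolynomial_eval_eq_xorVal K d ψ
  refine ⟨p, hp, ?_⟩
  have hm' : (0 : ℝ) < m := by exact_mod_cast hm
  classical
  rw [div_le_iff₀ hm', Nat.card_eq_fintype_card, Fintype.card_subtype]
  have hbad : ∀ j, MvPolynomial.eval (piMap (J j)) p ≠ xorVal (J j) ψ →
      K + d < 2 * (Finset.univ.filter fun i => KTuple.evalAt (J j) ψ i = 1).card ∨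
      K + d < 2 * (Finset.univ.filter fun i => KTuple.evalAt (J j) ψ i = -1).card := by
    intro j hj
    by_contra! h
    exact hj (by convert hpe (J j) (by convert h.1) (by convert h.2))
  rcases hdK.eq_or_lt with rfl | hdK
  · rw [Finset.filter_false_of_mem, Finset.card_empty, Nat.cast_zero]
    · positivity
    · intro j _ hj
      have hle : ∀ s : ℤˣ,
          (Finset.univ.filter fun i => KTuple.evalAt (J j) ψ i = s).card ≤ d := fun s =>
        (Finset.card_le_univ _).trans_eq (Fintype.card_fin d)
      have h1 := hle 1
      have h2 := hle (-1)
      rcases hbad j hj with h | h <;> omega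
  · have htail := fun s => hJ.card_filter_le_exp (by rwa [Fintype.card_fin]) hn ht hτ hd1 hdt hdK hcond ψ s
    simp only [Fintype.card_fin] at htail
    have hsub : (Finset.univ.filter fun j =>
        MvPolynomial.eval (piMap (J j)) p ≠ xorVal (J j) ψ) ⊆
        (Finset.univ.filter fun j => ((K : ℝ) + d) / 2 ≤
          (Finset.univ.filter fun i => KTuple.evalAt (J j) ψ i = 1).card) ∪
        (Finset.univ.filter fun j => ((K : ℝ) + d) / 2 ≤
          (Finset.univ.filter fun i => KTuple.evalAt (J j) ψ i = -1).card) := by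
      intro j hj
      simp only [Finset.mem_union, Finset.mem_filter, Finset.mem_univ, true_and]
      refine (hbad j (Finset.mem_filter.1 hj).2).imp (fun h => ?_) fun h => ?_
      all_goals
        rw [div_le_iff₀ two_pos, mul_comm]
        exact_mod_cast h.le
    have hcard := (Finset.card_le_card hsub).trans (Finset.card_union_le _ _)
    rw [two_mul, add_mul]
    refine (Nat.cast_le.2 hcard).trans ?_
    rw [Nat.cast_add]
    refine add_le_add ?_ ?_
    · convert htail 1
    · convert htail (-1)
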